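/- arXiv:2307.05459 — 4 statements merged into one kernel-verified Lean document; each statement's English description precedes it below -/
import Mathlib

section
/- Let M > 0 and let r : ℝ² → ℝ be a Schwarzschild double-null radius function with associated background quantities Ω², ω, κ, ρ. Let W, W̲, N, N̲, ϖ, P : ℝ² → ℝ be a smooth solution of the spherically symmetric linearised vacuum Einstein system in double null gauge. Define the connection-coefficient flux densities G(u,v) := r²·(−2·N·W̲ − (1/2)·W² + 4·ω·ϖ·W) and G̲(u,v) := r²·(−2·N̲·W − (1/2)·W̲² − 4·ω·ϖ·W̲). Then the pointwise conservation identity ∂G/∂u + ∂G̲/∂v = 0 holds at every point of ℝ². (This is the spherically symmetric case of the conservation law of Theorem 1.1, namely Holzegel's conservation law for the linearised connection coefficients, whose flux densities on the cones C_u and C̲_v are the integrands of F_u[Γ] and F_v[Γ].) -/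
open MeasureTheory Filter Set

/-- Partial derivative in the first (u) variable. -/
noncomputable def pdu (f : ℝ → ℝ → ℝ) (u v : ℝ) : ℝ := deriv (fun x => f x v) u

/-- Partial derivative in the second (v) variable. -/
noncomputable def pdv (f : ℝ → ℝ → ℝ) (u v : ℝ) : ℝ := deriv (fun y => f u y) v

/-- Schwarzschild double-null radius function: smooth, `r > 2M`,
`∂r/∂v = 1 − 2M/r`, `∂r/∂u = −(1 − 2M/r)`. -/
def IsSchwRadius (M : ℝ) (r : ℝ → ℝ → ℝ) : Prop :=
  ContDiff ℝ (⊤ : ℕ∞) (Function.uncurry r) ∧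
  (∀ u v, 2 * M < r u v) ∧
  (∀ u v, pdv r u v = 1 - 2 * M / r u v) ∧
  (∀ u v, pdu r u v = -(1 - 2 * M / r u v))

/-- Background lapse squared `Ω² = 1 − 2M/r`. -/
noncomputable def Om2 (M : ℝ) (r : ℝ → ℝ → ℝ) (u v : ℝ) : ℝ := 1 - 2 * M / r u v

/-- Background `ω = M/r²`. -/
noncomputable def om (M : ℝ) (r : ℝ → ℝ → ℝ) (u v : ℝ) : ℝ := M / (r u v) ^ 2

/-- Background `κ = 2Ω²/r = Ω tr χ`. -/
noncomputable def kap (M : ℝ) (r : ℝ → ℝ → ℝ) (u v : ℝ) : ℝ := 2 * Om2 M r u v / r u v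

/-- Background curvature `ρ = −2M/r³`. -/
noncomputable def rho (M : ℝ) (r : ℝ → ℝ → ℝ) (u v : ℝ) : ℝ := -(2 * M) / (r u v) ^ 3

/-- A smooth solution `(W, W̲, N, N̲, ϖ, P)` of the spherically symmetric linearised
vacuum Einstein system in double null gauge on the Schwarzschild exterior. -/
def IsLinSolution (M : ℝ) (r W Wb N Nb pp P : ℝ → ℝ → ℝ) : Prop :=
  ContDiff ℝ (⊤ : ℕ∞) (Function.uncurry W) ∧
  ContDiff ℝ (⊤ : ℕ∞) (Function.uncurry Wb) ∧
  ContDiff ℝ (⊤ : ℕ∞) (Function.uncurry N) ∧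
  ContDiff ℝ (⊤ : ℕ∞) (Function.uncurry Nb) ∧
  ContDiff ℝ (⊤ : ℕ∞) (Function.uncurry pp) ∧
  ContDiff ℝ (⊤ : ℕ∞) (Function.uncurry P) ∧
  (∀ u v, pdv W u v = (2 * om M r u v - kap M r u v) * W u v + 2 * kap M r u v * N u v) ∧
  (∀ u v, pdu Wb u v = (kap M r u v - 2 * om M r u v) * Wb u v - 2 * kap M r u v * Nb u v) ∧
  (∀ u v, pdv Wb u v =
    2 * Om2 M r u v * (P u v + 2 * rho M r u v * pp u v)
      - (kap M r u v / 2) * (Wb u v - W u v)) ∧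
  (∀ u v, pdu W u v =
    2 * Om2 M r u v * (P u v + 2 * rho M r u v * pp u v)
      - (kap M r u v / 2) * (Wb u v - W u v)) ∧
  (∀ u v, pdv Nb u v = -(Om2 M r u v) * (2 * rho M r u v * pp u v + P u v)) ∧
  (∀ u v, pdu N u v = -(Om2 M r u v) * (2 * rho M r u v * pp u v + P u v)) ∧
  (∀ u v, pdu pp u v = Nb u v) ∧
  (∀ u v, pdv pp u v = N u v) ∧
  (∀ u v, pdv P u v = -(3 / 2) * (kap M r u v * P u v + rho M r u v * W u v)) ∧
  (∀ u v, pdu P u v = (3 / 2) * (kap M r u v * P u v - rho M r u v * Wb u v))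

/-- Connection-coefficient flux density along the outgoing cones:
`G = r²(−2NW̲ − W²/2 + 4ωϖW)`. -/
noncomputable def Gconn (M : ℝ) (r W Wb N pp : ℝ → ℝ → ℝ) (u v : ℝ) : ℝ :=
  (r u v) ^ 2 *
    (-2 * N u v * Wb u v - (1 / 2) * (W u v) ^ 2 + 4 * om M r u v * pp u v * W u v)

/-- Connection-coefficient flux density along the ingoing cones:
`G̲ = r²(−2N̲W − W̲²/2 − 4ωϖW̲)`. -/
noncomputable def Gbconn (M : ℝ) (r W Wb Nb pp : ℝ → ℝ → ℝ) (u v : ℝ) : ℝ :=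
  (r u v) ^ 2 *
    (-2 * Nb u v * W u v - (1 / 2) * (Wb u v) ^ 2 - 4 * om M r u v * pp u v * Wb u v)

theorem hasDerivAt_pdu {f : ℝ → ℝ → ℝ} (hf : ContDiff ℝ (⊤ : ℕ∞) (Function.uncurry f)) (u v : ℝ) :
    HasDerivAt (fun x => f x v) (pdu f u v) u :=
  ((hf.differentiable (by simp)).comp
    (differentiable_id.prodMk (differentiable_const v)) u).hasDerivAt

theorem hasDerivAt_pdv {f : ℝ → ℝ → ℝ} (hf : ContDiff ℝ (⊤ : ℕ∞) (Function.uncurry f)) (u v : ℝ) :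
    HasDerivAt (fun y => f u y) (pdv f u v) v :=
  ((hf.differentiable (by simp)).comp
    ((differentiable_const u).prodMk differentiable_id) v).hasDerivAt

theorem Gconn_eq {M : ℝ} {r : ℝ → ℝ → ℝ} (W Wb N pp : ℝ → ℝ → ℝ) {u v : ℝ} (hr : r u v ≠ 0) :
    Gconn M r W Wb N pp u v =
      (r u v) ^ 2 * (-2 * (N u v * Wb u v) - (1 / 2) * (W u v) ^ 2)
        + 4 * M * (pp u v * W u v) := by
  simp only [Gconn, om]
  field_simp

theorem Gbconn_eq {M : ℝ} {r : ℝ → ℝ → ℝ} (W Wb Nb pp : ℝ → ℝ → ℝ) {u v : ℝ} (hr : r u v ≠ 0) :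
    Gbconn M r W Wb Nb pp u v =
      (r u v) ^ 2 * (-2 * (Nb u v * W u v) - (1 / 2) * (Wb u v) ^ 2)
        - 4 * M * (pp u v * Wb u v) := by
  simp only [Gbconn, om]
  field_simp

/-- Spherically symmetric case of Theorem 1.1 (Holzegel's conservation law for the
linearised connection coefficients), pointwise form: `∂G/∂u + ∂G̲/∂v = 0`. -/
theorem connection_flux_density_conservation
    (M : ℝ) (hM : 0 < M) (r W Wb N Nb pp P : ℝ → ℝ → ℝ)
    (hr : IsSchwRadius M r) (hsol : IsLinSolution M r W Wb N Nb pp P) :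
    ∀ u v : ℝ,
      pdu (Gconn M r W Wb N pp) u v + pdv (Gbconn M r W Wb Nb pp) u v = 0 := by
  intro u v
  obtain ⟨hr, hr2M, hrv, hru⟩ := hr
  obtain ⟨hW, hWb, hN, hNb, hpp, -, hWv, hWbu, hWbv, hWu, hNbv, hNu, hppu, hppv, -, -⟩ := hsol
  have hr0 : ∀ u v, r u v ≠ 0 := fun u v => ne_of_gt (by linarith [hr2M u v])
  have hG := ((((hasDerivAt_pdu hr u v).pow 2).mul
    ((((hasDerivAt_pdu hN u v).mul (hasDerivAt_pdu hWb u v)).const_mul (-2)).sub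
      (((hasDerivAt_pdu hW u v).pow 2).const_mul (1 / 2)))).add
    (((hasDerivAt_pdu hpp u v).mul (hasDerivAt_pdu hW u v)).const_mul (4 * M))).congr_of_eventuallyEq
    (Eventually.of_forall fun x => Gconn_eq W Wb N pp (hr0 x v))
  have hGb := ((((hasDerivAt_pdv hr u v).pow 2).mul
    ((((hasDerivAt_pdv hNb u v).mul (hasDerivAt_pdv hW u v)).const_mul (-2)).sub
      (((hasDerivAt_pdv hWb u v).pow 2).const_mul (1 / 2)))).sub
    (((hasDerivAt_pdv hpp u v).mul (hasDerivAt_pdv hWb u v)).const_mul (4 * M))).congr_of_eventuallyEq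
    (Eventually.of_forall fun y => Gbconn_eq W Wb Nb pp (hr0 u y))
  have h0 := hr0 u v
  rw [pdu, pdv, hG.deriv, hGb.deriv, hru, hrv, hNu, hNbv, hWu, hWv, hWbu, hWbv, hppu, hppv]
  simp only [kap, om, Om2, rho, Pi.mul_apply, Pi.sub_apply, Pi.pow_apply]
  field_simp
  ring
end

section
/- Let M > 0 and let r : ℝ² → ℝ be a Schwarzschild double-null radius function with associated background quantities Ω², ω, κ, ρ. Let W, W̲, N, N̲, ϖ, P : ℝ² → ℝ be a smooth solution of the spherically symmetric linearised vacuum Einstein system in double null gauge. With the connection-coefficient flux densities G(u,v) := r²·(−2·N·W̲ − (1/2)·W² + 4·ω·ϖ·W) and G̲(u,v) := r²·(−2·N̲·W − (1/2)·W̲² − 4·ω·ϖ·W̲), define the fluxes F_u(v₀,v₁) := ∫_{v₀}^{v₁} G(u,v) dv and F̲_v(u₀,u₁) := ∫_{u₀}^{u₁} G̲(u,v) du. Then for all real u₀, u₁, v₀, v₁ the conservation law F_{u₁}(v₀,v₁) + F̲_{v₁}(u₀,u₁) = F_{u₀}(v₀,v₁) + F̲_{v₀}(u₀,u₁) holds.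 (This is the spherically symmetric case of the conservation law (1.13) of Theorem 1.1, i.e. of Holzegel's conservation law for linearised connection coefficients on a characteristic rectangle of the Schwarzschild exterior.) -/
open MeasureTheory Filter Set

/-- Conservation law on a rectangle: if `∂f/∂u + ∂g/∂v = 0` then the flux of `(f, g)` through the
boundary of every coordinate rectangle vanishes. -/
theorem integral_add_integral_eq_of_divergence_eq_zero {f g : ℝ → ℝ → ℝ}
    (hf : Differentiable ℝ (Function.uncurry f)) (hg : Differentiable ℝ (Function.uncurry g))
    (hdiv : ∀ u v, pdu f u v + pdv g u v = 0) (u₀ u₁ v₀ v₁ : ℝ) :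
    (∫ v in v₀..v₁, f u₁ v) + (∫ u in u₀..u₁, g u v₁) =
      (∫ v in v₀..v₁, f u₀ v) + (∫ u in u₀..u₁, g u v₀) := by
  have hzero : ∀ x : ℝ × ℝ, fderiv ℝ (Function.uncurry f) x (1, 0) +
      fderiv ℝ (Function.uncurry g) x (0, 1) = 0 := by
    rintro ⟨u, v⟩
    have h₁ : HasDerivAt (fun x => f x v) (fderiv ℝ (Function.uncurry f) (u, v) (1, 0)) u :=
      (hf (u, v)).hasFDerivAt.comp_hasDerivAt (f := fun x => (x, v)) u
        ((hasDerivAt_id u).prodMk (hasDerivAt_const u v))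
    have h₂ : HasDerivAt (fun y => g u y) (fderiv ℝ (Function.uncurry g) (u, v) (0, 1)) v :=
      (hg (u, v)).hasFDerivAt.comp_hasDerivAt (f := fun y => (u, y)) v
        ((hasDerivAt_const v u).prodMk (hasDerivAt_id v))
    rw [← h₁.deriv, ← h₂.deriv]
    exact hdiv u v
  have key := integral2_divergence_prod_of_hasFDerivAt_off_countable
    (Function.uncurry f) (Function.uncurry g) (fderiv ℝ (Function.uncurry f))
    (fderiv ℝ (Function.uncurry g)) u₀ v₀ u₁ v₁ ∅ countable_empty
    hf.continuous.continuousOn hg.continuous.continuousOn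
    (fun x _ => (hf x).hasFDerivAt) (fun x _ => (hg x).hasFDerivAt)
    (by simp only [hzero]; exact integrableOn_zero)
  simp only [hzero, intervalIntegral.integral_zero, Function.uncurry_apply_pair] at key
  linarith

/-- The connection-coefficient flux densities are divergence free: `∂G/∂u + ∂G̲/∂v = 0`. -/
theorem pdu_Gconn_add_pdv_Gbconn {M : ℝ} (hM : 0 < M) {r W Wb N Nb pp P : ℝ → ℝ → ℝ}
    (hr : IsSchwRadius M r) (hsol : IsLinSolution M r W Wb N Nb pp P) (u v : ℝ) :
    pdu (Gconn M r W Wb N pp) u v + pdv (Gbconn M r W Wb Nb pp) u v = 0 := by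
  obtain ⟨sr, hpos, rv, ru⟩ := hr
  obtain ⟨sW, sWb, sN, sNb, spp, -, Wv, Wbu, Wbv, Wu, Nbv, Nu, ppu, ppv, -, -⟩ := hsol
  have h0 : r u v ≠ 0 := by linarith [hpos u v]
  have hG := ((hasDerivAt_pdu sr u v).fun_pow 2).fun_mul
    (((((hasDerivAt_pdu sN u v).const_mul (-2)).fun_mul (hasDerivAt_pdu sWb u v)).fun_sub
      (((hasDerivAt_pdu sW u v).fun_pow 2).const_mul (1 / 2))).fun_add
      (((((hasDerivAt_const u M).fun_div ((hasDerivAt_pdu sr u v).fun_pow 2)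
        (pow_ne_zero 2 h0)).const_mul 4).fun_mul (hasDerivAt_pdu spp u v)).fun_mul
        (hasDerivAt_pdu sW u v)))
  have hGb := ((hasDerivAt_pdv sr u v).fun_pow 2).fun_mul
    (((((hasDerivAt_pdv sNb u v).const_mul (-2)).fun_mul (hasDerivAt_pdv sW u v)).fun_sub
      (((hasDerivAt_pdv sWb u v).fun_pow 2).const_mul (1 / 2))).fun_sub
      (((((hasDerivAt_const v M).fun_div ((hasDerivAt_pdv sr u v).fun_pow 2)
        (pow_ne_zero 2 h0)).const_mul 4).fun_mul (hasDerivAt_pdv spp u v)).fun_mul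
        (hasDerivAt_pdv sWb u v)))
  have eG : pdu (Gconn M r W Wb N pp) u v = _ := hG.deriv
  have eGb : pdv (Gbconn M r W Wb Nb pp) u v = _ := hGb.deriv
  rw [eG, eGb, rv, ru, Wv, Wbu, Wbv, Wu, Nbv, Nu, ppu, ppv]
  simp only [kap, om, rho, Om2]
  field_simp
  ring

/-- Spherically symmetric case of the conservation law (1.13) of Theorem 1.1 on a
characteristic rectangle: `F_{u₁} + F̲_{v₁} = F_{u₀} + F̲_{v₀}`. -/
theorem connection_flux_conservation_law
    (M : ℝ) (hM : 0 < M) (r W Wb N Nb pp P : ℝ → ℝ → ℝ)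
    (hr : IsSchwRadius M r) (hsol : IsLinSolution M r W Wb N Nb pp P) :
    ∀ u₀ u₁ v₀ v₁ : ℝ,
      (∫ v in v₀..v₁, Gconn M r W Wb N pp u₁ v) +
        (∫ u in u₀..u₁, Gbconn M r W Wb Nb pp u v₁) =
      (∫ v in v₀..v₁, Gconn M r W Wb N pp u₀ v) +
        (∫ u in u₀..u₁, Gbconn M r W Wb Nb pp u v₀) := by
  obtain ⟨sr, hpos, -⟩ := id hr
  obtain ⟨sW, sWb, sN, sNb, spp, -⟩ := id hsol
  have h0 : ∀ x, Function.uncurry r x ≠ 0 := fun x => by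
    have := hpos x.1 x.2
    exact ne_of_gt (by simp only [Function.uncurry]; linarith)
  have hr' := sr.differentiable (by simp)
  have hω : Differentiable ℝ fun x => M / Function.uncurry r x ^ 2 :=
    (contDiff_const.div (sr.pow 2) fun x => pow_ne_zero 2 (h0 x)).differentiable (by simp)
  have hW := sW.differentiable (by simp)
  have hWb := sWb.differentiable (by simp)
  have hN := sN.differentiable (by simp)
  have hNb := sNb.differentiable (by simp)
  have hpp := spp.differentiable (by simp)
  refine integral_add_integral_eq_of_divergence_eq_zero ?_ ?_
    (pdu_Gconn_add_pdv_Gbconn hM hr hsol)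
  · exact (hr'.fun_pow 2).fun_mul ((((hN.const_mul (-2)).fun_mul hWb).fun_sub
      ((hW.fun_pow 2).const_mul (1 / 2))).fun_add (((hω.const_mul 4).fun_mul hpp).fun_mul hW))
  · exact (hr'.fun_pow 2).fun_mul ((((hNb.const_mul (-2)).fun_mul hW).fun_sub
      ((hWb.fun_pow 2).const_mul (1 / 2))).fun_sub (((hω.const_mul 4).fun_mul hpp).fun_mul hWb))
end

section
/- Let M > 0 and let r : ℝ² → ℝ be a Schwarzschild double-null radius function with associated background quantities Ω², ω, κ, ρ. Let W, W̲, N, N̲, ϖ, P : ℝ² → ℝ be a smooth solution of the spherically symmetric linearised vacuum Einstein system in double null gauge. Define the curvature flux densities G_R(u,v) := r⁴·((Ω²/2)·P² − (3ρ/2)·N·W̲ − (3ρ/2)·(κ/2 − 2ω)·ϖ·W) and G̲_R(u,v) := r⁴·((Ω²/2)·P² − (3ρ/2)·N̲·W + (3ρ/2)·(κ/2 − 2ω)·ϖ·W̲). Then the pointwise conservation identity ∂G_R/∂u + ∂G̲_R/∂v = 0 holds at every point of ℝ². (This is the spherically symmetric case of the conservation law of Theorem 1.2: the densities are the spherically symmetric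 reductions of the integrands of the fluxes F_u[ℛ] and F_v[ℛ] built from linearised curvature, including the sphere measure factor r².) -/
open MeasureTheory Filter Set

/-- Curvature flux density along the outgoing cones:
`G_R = r⁴((Ω²/2)P² − (3ρ/2)NW̲ − (3ρ/2)(κ/2 − 2ω)ϖW)`. -/
noncomputable def GR (M : ℝ) (r W Wb N pp P : ℝ → ℝ → ℝ) (u v : ℝ) : ℝ :=
  (r u v) ^ 4 *
    ((Om2 M r u v / 2) * (P u v) ^ 2
      - (3 * rho M r u v / 2) * N u v * Wb u v
      - (3 * rho M r u v / 2) * (kap M r u v / 2 - 2 * om M r u v) * pp u v * W u v)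

/-- Curvature flux density along the ingoing cones:
`G̲_R = r⁴((Ω²/2)P² − (3ρ/2)N̲W + (3ρ/2)(κ/2 − 2ω)ϖW̲)`. -/
noncomputable def GbR (M : ℝ) (r W Wb Nb pp P : ℝ → ℝ → ℝ) (u v : ℝ) : ℝ :=
  (r u v) ^ 4 *
    ((Om2 M r u v / 2) * (P u v) ^ 2
      - (3 * rho M r u v / 2) * Nb u v * W u v
      + (3 * rho M r u v / 2) * (kap M r u v / 2 - 2 * om M r u v) * pp u v * Wb u v)

/-- With the background quantities written in terms of `r`, a curvature flux density becomes a
quadratic expression whose coefficients are polynomials in `r` and `r⁻¹`; this is its derivative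
along a curve. The sign `s` distinguishes the outgoing from the ingoing density. -/
theorem hasDerivAt_fluxDensity {M s t r' P' N' W' p' V' : ℝ} {r P N W p V : ℝ → ℝ}
    (h0 : r t ≠ 0) (hr : HasDerivAt r r' t) (hP : HasDerivAt P P' t) (hN : HasDerivAt N N' t)
    (hW : HasDerivAt W W' t) (hp : HasDerivAt p p' t) (hV : HasDerivAt V V' t) :
    HasDerivAt
      (fun x => (r x ^ 4 - 2 * M * r x ^ 3) / 2 * P x ^ 2 + 3 * M * r x * N x * W x
        + s * (3 * M * (1 - 4 * M / r x)) * (p x * V x))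
      ((4 * r t ^ 3 - 6 * M * r t ^ 2) / 2 * r' * P t ^ 2
        + (r t ^ 4 - 2 * M * r t ^ 3) * P t * P'
        + 3 * M * (r' * N t * W t + r t * N' * W t + r t * N t * W')
        + s * (12 * M ^ 2 / r t ^ 2 * r') * (p t * V t)
        + s * (3 * M * (1 - 4 * M / r t)) * (p' * V t + p t * V')) t := by
  have hinv := (hasDerivAt_const t (4 * M)).fun_div hr h0
  have h := (((((hr.fun_pow 4).fun_sub ((hr.fun_pow 3).const_mul (2 * M))).div_const 2).fun_mul
    (hP.fun_pow 2)).fun_add (((hr.const_mul (3 * M)).fun_mul hN).fun_mul hW)).fun_add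
    ((((hinv.const_sub 1).const_mul (3 * M)).const_mul s).fun_mul (hp.fun_mul hV))
  refine h.congr_deriv ?_
  field_simp
  ring

/-- Spherically symmetric case of Theorem 1.2 (Holzegel's conservation law involving
linearised curvature), pointwise form: `∂G_R/∂u + ∂G̲_R/∂v = 0`. -/
theorem curvature_flux_density_conservation
    (M : ℝ) (hM : 0 < M) (r W Wb N Nb pp P : ℝ → ℝ → ℝ)
    (hr : IsSchwRadius M r) (hsol : IsLinSolution M r W Wb N Nb pp P) :
    ∀ u v : ℝ,
      pdu (GR M r W Wb N pp P) u v + pdv (GbR M r W Wb Nb pp P) u v = 0 := by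
  obtain ⟨hrs, hr2, hrv, hru⟩ := hr
  obtain ⟨sW, sWb, sN, sNb, sp, sP, hWv, hWbu, hWbv, hWu, hNbv, hNu, hpu, hpv, hPv, hPu⟩ := hsol
  have h0 (x y : ℝ) : r x y ≠ 0 := by
    have := hr2 x y
    have : 0 < r x y := by linarith
    exact this.ne'
  intro u v
  have hG : (fun x => GR M r W Wb N pp P x v) = fun x =>
      (r x v ^ 4 - 2 * M * r x v ^ 3) / 2 * P x v ^ 2 + 3 * M * r x v * N x v * Wb x v
        + 1 * (3 * M * (1 - 4 * M / r x v)) * (pp x v * W x v) := by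
    funext x
    have := h0 x v
    simp only [GR, Om2, om, kap, rho]
    field_simp
    ring
  have hGb : (fun y => GbR M r W Wb Nb pp P u y) = fun y =>
      (r u y ^ 4 - 2 * M * r u y ^ 3) / 2 * P u y ^ 2 + 3 * M * r u y * Nb u y * W u y
        + (-1) * (3 * M * (1 - 4 * M / r u y)) * (pp u y * Wb u y) := by
    funext y
    have := h0 u y
    simp only [GbR, Om2, om, kap, rho]
    field_simp
    ring
  have hGu := hasDerivAt_fluxDensity (M := M) (s := 1) (t := u) (r := fun x => r x v) (P := fun x => P x v)
    (N := fun x => N x v) (W := fun x => Wb x v) (p := fun x => pp x v) (V := fun x => W x v)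
    (h0 u v) (hasDerivAt_pdu hrs u v)
    (hasDerivAt_pdu sP u v) (hasDerivAt_pdu sN u v) (hasDerivAt_pdu sWb u v)
    (hasDerivAt_pdu sp u v) (hasDerivAt_pdu sW u v)
  have hGbv := hasDerivAt_fluxDensity (M := M) (s := -1) (t := v) (r := fun y => r u y) (P := fun y => P u y)
    (N := fun y => Nb u y) (W := fun y => W u y) (p := fun y => pp u y) (V := fun y => Wb u y)
    (h0 u v) (hasDerivAt_pdv hrs u v)
    (hasDerivAt_pdv sP u v) (hasDerivAt_pdv sNb u v) (hasDerivAt_pdv sW u v)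
    (hasDerivAt_pdv sp u v) (hasDerivAt_pdv sWb u v)
  have eG : pdu (GR M r W Wb N pp P) u v = _ := (congrArg (deriv · u) hG).trans hGu.deriv
  have eGb : pdv (GbR M r W Wb Nb pp P) u v = _ := (congrArg (deriv · v) hGb).trans hGbv.deriv
  rw [eG, eGb, hrv, hru, hWv, hWbu, hWbv, hWu, hNbv, hNu, hpu, hpv, hPv, hPu]
  have := h0 u v
  simp only [Om2, om, kap, rho]
  field_simp
  ring
end

section
/- Let M > 0 and let r : ℝ² → ℝ be a Schwarzschild double-null radius function with associated background quantities Ω², ω, κ, ρ. Let W, W̲, N, N̲, ϖ, P : ℝ² → ℝ be a smooth solution of the spherically symmetric linearised vacuum Einstein system in double null gauge. Define f₁ := −Ω²·(ω² + (5/4)·Ω²·ρ), f₂ := −(3/4)·Ω⁴·ρ, f₃ := 2Ω²·(Ω²·ρ − ω²), and the flux densities Ġ(u,v) := r²·( (3/2)·Ω⁴·P² − (f₃/Ω²)·N·W̲ + (2/Ω²)·(ω·f₃ + 2κ·f₂)·ϖ·W − (f₁/(2Ω²))·W² − (f₂/(2Ω²))·(W̲ + 2κϖ)² ) and Ġ̲(u,v)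 := r²·( (3/2)·Ω⁴·P² − (f₃/Ω²)·N̲·W − (2/Ω²)·(ω·f₃ + 2κ·f₂)·ϖ·W̲ − (f₁/(2Ω²))·W̲² − (f₂/(2Ω²))·(W − 2κϖ)² ). Then the pointwise conservation identity ∂Ġ/∂u + ∂Ġ̲/∂v = 0 holds at every point of ℝ². (This is the spherically symmetric case of the novel conservation law of Theorem 1.5 for the Teukolsky-type fluxes Ḟ_u[ℛ], Ḟ_v[ℛ]: the densities are the spherically symmetric reductions of their integrands, including the sphere measure factor r².) -/
open MeasureTheory Filter Set

/-- `f₁ = −Ω²(ω² + (5/4)Ω²ρ)`. -/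
noncomputable def f1 (M : ℝ) (r : ℝ → ℝ → ℝ) (u v : ℝ) : ℝ :=
  -(Om2 M r u v) * ((om M r u v) ^ 2 + (5 / 4) * Om2 M r u v * rho M r u v)

/-- `f₂ = −(3/4)Ω⁴ρ`. -/
noncomputable def f2 (M : ℝ) (r : ℝ → ℝ → ℝ) (u v : ℝ) : ℝ :=
  -(3 / 4) * (Om2 M r u v) ^ 2 * rho M r u v

/-- `f₃ = 2Ω²(Ω²ρ − ω²)`. -/
noncomputable def f3 (M : ℝ) (r : ℝ → ℝ → ℝ) (u v : ℝ) : ℝ :=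
  2 * Om2 M r u v * (Om2 M r u v * rho M r u v - (om M r u v) ^ 2)

/-- Teukolsky-type flux density along the outgoing cones (integrand of `Ḟ_u[ℛ]`):
`Ġ = r²((3/2)Ω⁴P² − (f₃/Ω²)NW̲ + (2/Ω²)(ωf₃ + 2κf₂)ϖW − (f₁/2Ω²)W² − (f₂/2Ω²)(W̲ + 2κϖ)²)`. -/
noncomputable def Gdot (M : ℝ) (r W Wb N pp P : ℝ → ℝ → ℝ) (u v : ℝ) : ℝ :=
  (r u v) ^ 2 *
    ((3 / 2) * (Om2 M r u v) ^ 2 * (P u v) ^ 2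
      - (f3 M r u v / Om2 M r u v) * N u v * Wb u v
      + (2 / Om2 M r u v) * (om M r u v * f3 M r u v + 2 * kap M r u v * f2 M r u v)
          * pp u v * W u v
      - (f1 M r u v / (2 * Om2 M r u v)) * (W u v) ^ 2
      - (f2 M r u v / (2 * Om2 M r u v)) * (Wb u v + 2 * kap M r u v * pp u v) ^ 2)

/-- Teukolsky-type flux density along the ingoing cones (integrand of `Ḟ_v[ℛ]`):
`Ġ̲ = r²((3/2)Ω⁴P² − (f₃/Ω²)N̲W − (2/Ω²)(ωf₃ + 2κf₂)ϖW̲ − (f₁/2Ω²)W̲² − (f₂/2Ω²)(W − 2κϖ)²)`. -/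
noncomputable def Gbdot (M : ℝ) (r W Wb Nb pp P : ℝ → ℝ → ℝ) (u v : ℝ) : ℝ :=
  (r u v) ^ 2 *
    ((3 / 2) * (Om2 M r u v) ^ 2 * (P u v) ^ 2
      - (f3 M r u v / Om2 M r u v) * Nb u v * W u v
      - (2 / Om2 M r u v) * (om M r u v * f3 M r u v + 2 * kap M r u v * f2 M r u v)
          * pp u v * Wb u v
      - (f1 M r u v / (2 * Om2 M r u v)) * (Wb u v) ^ 2
      - (f2 M r u v / (2 * Om2 M r u v)) * (W u v - 2 * kap M r u v * pp u v) ^ 2)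

/-- The common polynomial form of the two flux densities in `R = r` and `s = 1 / r`; the sign `σ`
is `1` on the outgoing cones and `-1` on the ingoing ones. -/
noncomputable def fluxPoly (σ M R s A B n p P : ℝ) : ℝ :=
  3 / 2 * (R - 2 * M) ^ 2 * P ^ 2
    + (4 * M * s * (1 - 2 * M * s) + 2 * M ^ 2 * s ^ 2) * (n * B)
    + σ * (12 * M * s ^ 2 * (1 - 2 * M * s) ^ 2 - 8 * M ^ 2 * s ^ 3 * (1 - 2 * M * s)
        - 4 * M ^ 3 * s ^ 4) * (p * A)
    + (M ^ 2 * s ^ 2 / 2 - 5 / 4 * M * s * (1 - 2 * M * s)) * A ^ 2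
    - 3 / 4 * M * s * (1 - 2 * M * s) * (B + 4 * σ * s * (1 - 2 * M * s) * p) ^ 2

theorem Gdot_eq_fluxPoly {M : ℝ} {r : ℝ → ℝ → ℝ} (W Wb N pp P : ℝ → ℝ → ℝ) {u v : ℝ}
    (hr : r u v ≠ 0) (hM : r u v - 2 * M ≠ 0) :
    Gdot M r W Wb N pp P u v =
      fluxPoly 1 M (r u v) (r u v)⁻¹ (W u v) (Wb u v) (N u v) (pp u v) (P u v) := by
  simp only [Gdot, f1, f2, f3, kap, om, rho, Om2, fluxPoly]
  field_simp
  ring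

theorem Gbdot_eq_fluxPoly {M : ℝ} {r : ℝ → ℝ → ℝ} (W Wb Nb pp P : ℝ → ℝ → ℝ) {u v : ℝ}
    (hr : r u v ≠ 0) (hM : r u v - 2 * M ≠ 0) :
    Gbdot M r W Wb Nb pp P u v =
      fluxPoly (-1) M (r u v) (r u v)⁻¹ (Wb u v) (W u v) (Nb u v) (pp u v) (P u v) := by
  simp only [Gbdot, f1, f2, f3, kap, om, rho, Om2, fluxPoly]
  field_simp
  ring

theorem hasDerivAt_fluxPoly (σ M : ℝ) {R s A B n p P : ℝ → ℝ} {R' s' A' B' n' p' P' x : ℝ}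
    (hR : HasDerivAt R R' x) (hs : HasDerivAt s s' x) (hA : HasDerivAt A A' x)
    (hB : HasDerivAt B B' x) (hn : HasDerivAt n n' x) (hp : HasDerivAt p p' x)
    (hP : HasDerivAt P P' x) :
    HasDerivAt (fun y => fluxPoly σ M (R y) (s y) (A y) (B y) (n y) (p y) (P y))
      (3 * (R x - 2 * M) * P x * (R' * P x + (R x - 2 * M) * P')
        + (4 * M - 12 * M ^ 2 * s x) * s' * (n x * B x)
        + (4 * M * s x - 6 * M ^ 2 * s x ^ 2) * (n' * B x + n x * B')
        + σ * (24 * M * s x - 168 * M ^ 2 * s x ^ 2 + 240 * M ^ 3 * s x ^ 3) * s' * (p x * A x)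
        + σ * (12 * M * s x ^ 2 - 56 * M ^ 2 * s x ^ 3 + 60 * M ^ 3 * s x ^ 4)
            * (p' * A x + p x * A')
        + (6 * M ^ 2 * s x - 5 / 4 * M) * s' * A x ^ 2
        + (6 * M ^ 2 * s x ^ 2 - 5 / 2 * M * s x) * A x * A'
        - 3 / 4 * M * (1 - 4 * M * s x) * s' * (B x + 4 * σ * s x * (1 - 2 * M * s x) * p x) ^ 2
        - 3 / 2 * M * s x * (1 - 2 * M * s x) * (B x + 4 * σ * s x * (1 - 2 * M * s x) * p x)
            * (B' + 4 * σ * (1 - 4 * M * s x) * s' * p x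
              + 4 * σ * s x * (1 - 2 * M * s x) * p')) x := by
  have hO : HasDerivAt (fun y => 1 - 2 * M * s y) (-(2 * M * s')) x :=
    (hs.const_mul (2 * M)).const_sub 1
  have hPP := (((hR.sub_const (2 * M)).fun_pow 2).const_mul (3 / 2)).fun_mul (hP.fun_pow 2)
  have hnB := (((hs.const_mul (4 * M)).fun_mul hO).fun_add
    ((hs.fun_pow 2).const_mul (2 * M ^ 2))).fun_mul (hn.fun_mul hB)
  have hpA := ((((((hs.fun_pow 2).const_mul (12 * M)).fun_mul (hO.fun_pow 2)).fun_sub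
    (((hs.fun_pow 3).const_mul (8 * M ^ 2)).fun_mul hO)).fun_sub
    ((hs.fun_pow 4).const_mul (4 * M ^ 3))).const_mul σ).fun_mul (hp.fun_mul hA)
  have hAA := ((((hs.fun_pow 2).const_mul (M ^ 2)).div_const 2).fun_sub
    ((hs.const_mul (5 / 4 * M)).fun_mul hO)).fun_mul (hA.fun_pow 2)
  have hBp := ((hs.const_mul (3 / 4 * M)).fun_mul hO).fun_mul
    ((hB.fun_add (((hs.const_mul (4 * σ)).fun_mul hO).fun_mul hp)).fun_pow 2)
  refine ((((hPP.fun_add hnB).fun_add hpA).fun_add hAA).fun_sub hBp).congr_deriv ?_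
  norm_num
  ring

/-- Spherically symmetric case of the novel conservation law of Theorem 1.5,
pointwise form: `∂Ġ/∂u + ∂Ġ̲/∂v = 0`. -/
theorem teukolsky_flux_density_conservation
    (M : ℝ) (hM : 0 < M) (r W Wb N Nb pp P : ℝ → ℝ → ℝ)
    (hr : IsSchwRadius M r) (hsol : IsLinSolution M r W Wb N Nb pp P) :
    ∀ u v : ℝ,
      pdu (Gdot M r W Wb N pp P) u v + pdv (Gbdot M r W Wb Nb pp P) u v = 0 := by
  intro u v
  obtain ⟨hrs, hr2, hrv, hru⟩ := hr
  obtain ⟨hW, hWb, hN, hNb, hpp, hP, hWv, hWbu, hWbv, hWu, hNbv, hNu, hppu, hppv, hPv, hPu⟩ := hsol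
  have hr0 : ∀ a b, r a b ≠ 0 := fun a b => (by linarith [hr2 a b] : 0 < r a b).ne'
  have hrM : ∀ a b, r a b - 2 * M ≠ 0 := fun a b => (sub_pos.mpr (hr2 a b)).ne'
  have hGu := hasDerivAt_fluxPoly 1 M (hasDerivAt_pdu hrs u v)
    ((hasDerivAt_pdu hrs u v).fun_inv (hr0 u v)) (hasDerivAt_pdu hW u v) (hasDerivAt_pdu hWb u v)
    (hasDerivAt_pdu hN u v) (hasDerivAt_pdu hpp u v) (hasDerivAt_pdu hP u v)
  have hGv := hasDerivAt_fluxPoly (-1) M (hasDerivAt_pdv hrs u v)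
    ((hasDerivAt_pdv hrs u v).fun_inv (hr0 u v)) (hasDerivAt_pdv hWb u v) (hasDerivAt_pdv hW u v)
    (hasDerivAt_pdv hNb u v) (hasDerivAt_pdv hpp u v) (hasDerivAt_pdv hP u v)
  rw [pdu, pdv]
  simp only [Gdot_eq_fluxPoly _ _ _ _ _ (hr0 _ _) (hrM _ _),
    Gbdot_eq_fluxPoly _ _ _ _ _ (hr0 _ _) (hrM _ _)]
  rw [hGu.deriv, hGv.deriv, hrv, hru, hWv, hWbu, hWbv, hWu, hNbv, hNu, hppu, hppv, hPv, hPu]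
  simp only [kap, om, rho, Om2]
  have h := hr0 u v
  field_simp
  ring
end
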